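/- Let ψ₁ < ψ₂ and let h₀ : [ψ₁,ψ₂] → ℝ be continuous. (i) Let μ₁ < min h₀, set R = {(φ,ψ) : μ₁ < φ < h₀(ψ), ψ₁ < ψ < ψ₂}, and suppose q : cl R → ℝ is Lipschitz continuous on cl R, is C² in R and satisfies (⋆) in R, with q(h₀(ψ),ψ) = c_* for all ψ ∈ [ψ₁,ψ₂] and q < c_* on cl R ∖ {(h₀(ψ),ψ) : ψ₁ ≤ ψ ≤ ψ₂}. Then h₀(ψ) ≥ min{h₀(ψ₁), h₀(ψ₂)} for all ψ ∈ [ψ₁,ψ₂]. (ii) Symmetrically, let μ₂ > max h₀, set R' = {(φ,ψ) : h₀(ψ) < φ < μ₂, ψ₁ < ψ < ψ₂}, and suppose q : cl R' → ℝ is Lipschitz continuous on cl R', is C² in R' and satisfies (⋆) in R', with q(h₀(ψ),ψ) = c_* for all ψ and q < c_* on cl R' ∖ {(h₀(ψ),ψ)}. Then h₀(ψ) ≤ max{h₀(ψ₁), h₀(ψ₂)} for all ψ ∈ [ψ₁,ψ₂]. -/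

import Mathlib

open Real Set MeasureTheory Filter

noncomputable section

/-- The density function `ρ(t) = (1 − ((γ−1)/2) t)^{1/(γ−1)}`. -/
def rhoF (γ t : ℝ) : ℝ := (1 - (γ - 1) / 2 * t) ^ ((1 : ℝ) / (γ - 1))

/-- The critical (sonic) speed `c_* = (2/(γ+1))^{1/2}`. -/
def cstar (γ : ℝ) : ℝ := Real.sqrt (2 / (γ + 1))

/-- The maximal speed `q_max = (2/(γ−1))^{1/2}`. -/
def qmaxF (γ : ℝ) : ℝ := Real.sqrt (2 / (γ - 1))

/-- `A(q) = ∫_{c_*}^q (ρ(s²)+2s²ρ'(s²))/(s ρ(s²)²) ds`. -/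
def Afun (γ q : ℝ) : ℝ :=
  ∫ s in (cstar γ)..q,
    (rhoF γ (s ^ 2) + 2 * s ^ 2 * deriv (rhoF γ) (s ^ 2)) / (s * (rhoF γ (s ^ 2)) ^ 2)

/-- `B(q) = ∫_{c_*}^q ρ(s²)/s ds`. -/
def Bfun (γ q : ℝ) : ℝ := ∫ s in (cstar γ)..q, rhoF γ (s ^ 2) / s

/-- Inverse of `A` restricted to `[c_*, q_max)`. -/
def AplusInv (γ : ℝ) : ℝ → ℝ := Function.invFunOn (Afun γ) (Ico (cstar γ) (qmaxF γ))

/-- `K(s) = B(A₊⁻¹(s))`. -/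
def Kfun (γ s : ℝ) : ℝ := Bfun γ (AplusInv γ s)

/-- `b(s) = −K'(s)`. -/
def bfun (γ s : ℝ) : ℝ := -deriv (Kfun γ) s

/-- `p(s) = −K''(s)`. -/
def pfun (γ s : ℝ) : ℝ := -deriv (deriv (Kfun γ)) s

/-- Partial derivative in the first (potential) variable. -/
def pdx (u : ℝ × ℝ → ℝ) (p : ℝ × ℝ) : ℝ := deriv (fun x => u (x, p.2)) p.1

/-- Partial derivative in the second (stream) variable. -/
def pdy (u : ℝ × ℝ → ℝ) (p : ℝ × ℝ) : ℝ := deriv (fun y => u (p.1, y)) p.2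

/-- The Chaplygin equation (⋆) at a point. -/
def chap (γ : ℝ) (q : ℝ × ℝ → ℝ) (p : ℝ × ℝ) : Prop :=
  pdx (pdx fun z => Afun γ (q z)) p + pdy (pdy fun z => Bfun γ (q z)) p = 0


lemma dd_nonpos {f : ℝ → ℝ} {x : ℝ} (h : IsLocalMax f x) (hc : ContinuousAt f x) :
    deriv (deriv f) x ≤ 0 := by
  by_contra hpos
  push Not at hpos
  have hmin := isLocalMin_of_deriv_deriv_pos hpos h.deriv_eq_zero hc
  have heq : f =ᶠ[nhds x] fun _ => f x := by
    filter_upwards [h, hmin] with y h1 h2 using le_antisymm h1 h2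
  have h3 := heq.deriv.deriv_eq
  simp at h3
  linarith

lemma core_strip (A B I : ℝ → ℝ) (a cs : ℝ) (hac : a < cs)
    (hA : StrictMonoOn A (Icc a cs)) (hB : MonotoneOn B (Icc a cs))
    (hA0 : A cs = 0) (hAd0 : HasDerivAt A 0 cs)
    (hAd : ∀ t ∈ Icc a cs, HasDerivAt A (I t) t)
    (hI : ∀ t ∈ Icc a cs, DifferentiableAt ℝ I t)
    (hBc : ∀ t ∈ Icc a cs, ContinuousAt B t)
    (δ y1 y2 : ℝ) (hδ : 0 < δ)
    (q : ℝ × ℝ → ℝ) (L : NNReal)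
    (hL : LipschitzOnWith L q (Icc 0 δ ×ˢ Icc y1 y2))
    (hC : ContDiffOn ℝ 2 q (Ioo 0 δ ×ˢ Ioo y1 y2))
    (heq : ∀ p ∈ Ioo 0 δ ×ˢ Ioo y1 y2,
      deriv (deriv fun x => A (q (x, p.2))) p.1 + deriv (deriv fun y => B (q (p.1, y))) p.2 = 0)
    (hle : ∀ p ∈ Icc 0 δ ×ˢ Icc y1 y2, q p ≤ cs)
    (hlt : ∀ p ∈ Icc 0 δ ×ˢ Icc y1 y2, (0 < p.1 ∨ p.2 = y1 ∨ p.2 = y2) → q p < cs)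
    (y0 : ℝ) (hy0 : y0 ∈ Icc y1 y2) (hq0 : q (0, y0) = cs) : False := by
  set g : ℝ → ℝ := fun t => - A (max t a) with hg
  have hmem : ∀ t ≤ cs, max t a ∈ Icc a cs := fun t ht => ⟨le_max_right _ _, max_le ht hac.le⟩
  have hcs : cs ∈ Icc a cs := ⟨hac.le, le_rfl⟩
  have hgpos : ∀ t < cs, 0 < g t := by
    intro t ht
    have := hA (hmem t ht.le) hcs (max_lt ht hac)
    simp only [hg]; linarith
  have hgnn : ∀ t ≤ cs, 0 ≤ g t := by
    intro t ht
    have := hA.monotoneOn (hmem t ht) hcs (max_le ht hac.le)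
    simp only [hg]; linarith
  have hgc : ContinuousOn (fun p => g (q p)) (Icc 0 δ ×ˢ Icc y1 y2) := by
    have hAc : ContinuousOn A (Icc a cs) := fun t ht => (hAd t ht).continuousAt.continuousWithinAt
    refine (hAc.comp (ContinuousOn.sup hL.continuousOn continuousOn_const) ?_).neg
    intro p hp
    exact hmem _ (hle p hp)
  have hcomp : IsCompact (Icc (0:ℝ) δ ×ˢ Icc y1 y2) := isCompact_Icc.prod isCompact_Icc
  -- lower bound on the lateral boundary
  obtain ⟨c0, hc0, hc0b⟩ : ∃ c0 > 0, ∀ p ∈ Icc 0 δ ×ˢ Icc y1 y2,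
      (p.1 = δ ∨ p.2 = y1 ∨ p.2 = y2) → c0 ≤ g (q p) := by
    set K : Set (ℝ × ℝ) := (Icc 0 δ ×ˢ Icc y1 y2) ∩ {p | p.1 = δ ∨ p.2 = y1 ∨ p.2 = y2} with hK
    have hKc : IsCompact K := by
      apply hcomp.inter_right
      exact (isClosed_eq continuous_fst continuous_const).union
        ((isClosed_eq continuous_snd continuous_const).union
          (isClosed_eq continuous_snd continuous_const))
    have hKne : K.Nonempty := ⟨(δ, y0), ⟨⟨⟨hδ.le, le_rfl⟩, hy0⟩, Or.inl rfl⟩⟩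
    obtain ⟨p, hp, hpm⟩ := hKc.exists_isMinOn hKne (hgc.mono inter_subset_left)
    refine ⟨g (q p), hgpos _ (hlt p hp.1 ?_), fun p' hp' h' => hpm ⟨hp', h'⟩⟩
    rcases hp.2 with h | h
    · left; rw [h]; exact hδ
    · right; exact h
  have hga : 0 < g a := hgpos a hac
  obtain ⟨c, hc, hcb⟩ : ∃ c > 0, c * (δ + δ ^ 2) < min c0 (g a) := by
    have h1 : 0 < min c0 (g a) := lt_min hc0 hga
    have h2 : 0 < δ + δ ^ 2 := by positivity
    refine ⟨min c0 (g a) / (2 * (δ + δ ^ 2)), by positivity, ?_⟩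
    rw [div_mul_eq_mul_div, div_lt_iff₀ (by positivity)]
    nlinarith [mul_pos h1 h2]
  have hfle : ∀ s ∈ Icc 0 δ, c * (s + s ^ 2) ≤ c * (δ + δ ^ 2) := by
    intro s hs
    have := hs.1; have := hs.2
    gcongr
  -- comparison
  have hcmp : ∀ p ∈ Icc 0 δ ×ˢ Icc y1 y2, 0 ≤ g (q p) - c * (p.1 + p.1 ^ 2) := by
    have hWc : ContinuousOn (fun p : ℝ × ℝ => g (q p) - c * (p.1 + p.1 ^ 2))
        (Icc 0 δ ×ˢ Icc y1 y2) := hgc.sub (by fun_prop)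
    obtain ⟨p, hp, hpm⟩ := hcomp.exists_isMinOn ⟨(δ, y0), ⟨⟨hδ.le, le_rfl⟩, hy0⟩⟩ hWc
    suffices h : 0 ≤ g (q p) - c * (p.1 + p.1 ^ 2) from fun p' hp' => h.trans (hpm hp')
    by_contra hneg
    push Not at hneg
    have hlat : ¬ (p.1 = δ ∨ p.2 = y1 ∨ p.2 = y2) := by
      intro h
      have h1 := hc0b p hp h
      have h2 := hfle p.1 hp.1
      have h3 := min_le_left c0 (g a)
      linarith
    have hp0 : p.1 ≠ 0 := by
      intro h
      have := hgnn _ (hle p hp)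
      rw [h] at hneg
      simp at hneg
      linarith
    push Not at hlat
    obtain ⟨x, y⟩ := p
    simp only at hneg hlat hp0
    have hx : x ∈ Ioo 0 δ := ⟨lt_of_le_of_ne hp.1.1 (Ne.symm hp0), lt_of_le_of_ne hp.1.2 hlat.1⟩
    have hy : y ∈ Ioo y1 y2 :=
      ⟨lt_of_le_of_ne hp.2.1 (Ne.symm hlat.2.1), lt_of_le_of_ne hp.2.2 hlat.2.2⟩
    have hqa : a < q (x, y) := by
      by_contra h
      push Not at h
      have h1 : g (q (x, y)) = g a := by simp [hg, max_eq_right h]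
      have h2 := hfle x hp.1
      have h3 := min_le_right c0 (g a)
      linarith
    have hopen : IsOpen (Ioo (0:ℝ) δ ×ˢ Ioo y1 y2) := isOpen_Ioo.prod isOpen_Ioo
    have hqlt : q (x, y) < cs := hlt _ hp (Or.inl hx.1)
    have hqC : ContDiffAt ℝ 2 q (x, y) := hC.contDiffAt (hopen.mem_nhds ⟨hx, hy⟩)
    -- ψ direction
    have hqyc : ContinuousAt (fun y' => q (x, y')) y :=
      ContinuousAt.comp (f := fun y' => (x, y')) hqC.continuousAt (by fun_prop)
    have hBdd : deriv (deriv fun y' => B (q (x, y'))) y ≤ 0 := by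
      apply dd_nonpos
      · have e1 : ∀ᶠ y' in nhds y, a < q (x, y') := hqyc.eventually (lt_mem_nhds hqa)
        filter_upwards [e1, isOpen_Ioo.mem_nhds hy] with y' h1 h2
        have hp' : (x, y') ∈ Icc 0 δ ×ˢ Icc y1 y2 := ⟨hp.1, Ioo_subset_Icc_self h2⟩
        have hm : g (q (x, y)) - c * (x + x ^ 2) ≤ g (q (x, y')) - c * (x + x ^ 2) := hpm hp'
        simp only [hg, max_eq_left hqa.le, max_eq_left h1.le] at hm
        have m1 : q (x, y) ∈ Icc a cs := ⟨hqa.le, hqlt.le⟩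
        have m2 : q (x, y') ∈ Icc a cs := ⟨h1.le, hle _ hp'⟩
        apply hB m2 m1
        rw [← hA.le_iff_le m2 m1]
        linarith
      · exact ContinuousAt.comp (f := fun y' => q (x, y')) (hBc _ ⟨hqa.le, hqlt.le⟩) hqyc
    -- φ direction
    set k : ℝ → ℝ := fun x' => q (x', y) with hk
    have hkC : ContDiffAt ℝ 2 k x :=
      ContDiffAt.comp (f := fun x' => (x', y)) x hqC (by fun_prop)
    have hkc : ContinuousAt k x := hkC.continuousAt
    have e1 : ∀ᶠ x' in nhds x, a < k x' := hkc.eventually (lt_mem_nhds hqa)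
    have e2 : ∀ᶠ x' in nhds x, x' ∈ Ioo 0 δ := isOpen_Ioo.mem_nhds hx
    have e3 : ∀ᶠ x' in nhds x, DifferentiableAt ℝ k x' := by
      filter_upwards [hkC.eventually (by simp)] with x' h
      exact h.differentiableAt (by simp)
    have e4 : ∀ᶠ x' in nhds x, HasDerivAt (fun x' => A (k x')) (I (k x') * deriv k x') x' := by
      filter_upwards [e1, e2, e3] with x' h1 h2 h3
      have hp' : (x', y) ∈ Icc 0 δ ×ˢ Icc y1 y2 := ⟨Ioo_subset_Icc_self h2, hp.2⟩
      exact (hAd _ ⟨h1.le, hle _ hp'⟩).comp x' h3.hasDerivAt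
    have hdk : DifferentiableAt ℝ (deriv k) x := by
      have : ContDiffAt ℝ 1 (deriv k) x := by
        exact (hkC.fderiv_right (m := 1) (by norm_num)).clm_apply contDiffAt_const
      exact this.differentiableAt (by simp)
    have hD : DifferentiableAt ℝ (fun x' => I (k x') * deriv k x') x :=
      (DifferentiableAt.comp x (hI _ ⟨hqa.le, hqlt.le⟩) e3.self_of_nhds).mul hdk
    have hdA : deriv (fun x' => A (k x')) =ᶠ[nhds x] fun x' => I (k x') * deriv k x' := by
      filter_upwards [e4] with x' h using h.deriv
    have hdF : deriv (fun x' => A (k x') + c * (x' + x' ^ 2)) =ᶠ[nhds x]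
        fun x' => I (k x') * deriv k x' + c * (1 + 2 * x') := by
      filter_upwards [e4] with x' h
      have h2 : HasDerivAt (fun x' : ℝ => c * (x' + x' ^ 2)) (c * (1 + 2 * x')) x' := by
        have := ((hasDerivAt_id x').add (hasDerivAt_pow 2 x')).const_mul c
        simpa using this
      exact (h.add h2).deriv
    have hmax : deriv (deriv (fun x' => A (k x') + c * (x' + x' ^ 2))) x ≤ 0 := by
      apply dd_nonpos
      · filter_upwards [e1, e2] with x' h1 h2
        have hp' : (x', y) ∈ Icc 0 δ ×ˢ Icc y1 y2 := ⟨Ioo_subset_Icc_self h2, hp.2⟩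
        have hm : g (k x) - c * (x + x ^ 2) ≤ g (k x') - c * (x' + x' ^ 2) := hpm hp'
        have hqa' : a < k x := hqa
        simp only [hg, max_eq_left hqa'.le, max_eq_left h1.le] at hm
        linarith
      · exact e4.self_of_nhds.continuousAt.add (by fun_prop)
    rw [hdF.deriv_eq] at hmax
    have h2 : HasDerivAt (fun x' : ℝ => c * (1 + 2 * x')) (c * 2) x := by
      have := (((hasDerivAt_id x).const_mul 2).const_add 1).const_mul c
      simpa using this
    have h5 : deriv (fun x' => I (k x') * deriv k x' + c * (1 + 2 * x')) x = _ :=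
      (hD.hasDerivAt.add h2).deriv
    rw [h5] at hmax
    have h3 := heq (x, y) ⟨hx, hy⟩
    simp only at h3
    have h4 : deriv (deriv fun x' => A (q (x', y))) x = _ := hdA.deriv_eq
    rw [h4] at h3
    linarith
  -- contradiction at (0,y0)
  have hev := (hasDerivAt_iff_isLittleO.1 hAd0).def (c := c / (2 * (L + 1))) (by positivity)
  have hline : Tendsto (fun s : ℝ => q (s, y0)) (nhdsWithin 0 (Ioo 0 δ)) (nhds cs) := by
    have hcw := hL.continuousOn (0, y0) ⟨⟨le_rfl, hδ.le⟩, hy0⟩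
    rw [ContinuousWithinAt, hq0] at hcw
    refine hcw.comp ?_
    apply tendsto_nhdsWithin_of_tendsto_nhds_of_eventually_within
    · apply Tendsto.mono_left _ nhdsWithin_le_nhds
      exact Continuous.tendsto' (by fun_prop) _ _ rfl
    · filter_upwards [self_mem_nhdsWithin] with s hs
      exact ⟨Ioo_subset_Icc_self hs, hy0⟩
  have hne : (nhdsWithin (0:ℝ) (Ioo 0 δ)).NeBot := left_nhdsWithin_Ioo_neBot hδ
  obtain ⟨s, ⟨hs1, hs2⟩, hs⟩ := ((hline.eventually hev).and
    ((hline.eventually (lt_mem_nhds hac)).and self_mem_nhdsWithin) |>.mono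
      (fun s h => (⟨⟨h.1, h.2.1⟩, h.2.2⟩ : ((_ ∧ _) ∧ _)))).exists
  have hsI : s ∈ Icc 0 δ := Ioo_subset_Icc_self hs
  have h1 := hcmp (s, y0) ⟨hsI, hy0⟩
  simp only [hg, max_eq_left hs2.le] at h1
  simp only [hA0, smul_zero, sub_zero, Real.norm_eq_abs] at hs1
  have h2 := hL.dist_le_mul (s, y0) ⟨hsI, hy0⟩ (0, y0) ⟨⟨le_rfl, hδ.le⟩, hy0⟩
  rw [hq0, Real.dist_eq, Prod.dist_eq] at h2
  simp only [dist_self, Real.dist_eq, sub_zero, abs_of_pos hs.1, max_eq_left hs.1.le] at h2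
  have h3 : c / (2 * (L + 1)) * |q (s, y0) - cs| ≤ c / (2 * (L + 1)) * (L * s) := by gcongr
  have h4 : c / (2 * (L + 1)) * (L * s) ≤ c * s / 2 := by
    rw [div_mul_eq_mul_div, div_le_div_iff₀ (by positivity) (by positivity)]
    nlinarith [mul_pos hc hs.1]
  have h5 := neg_abs_le (A (q (s, y0)))
  have h6 : 0 < c * s := mul_pos hc hs.1
  have h7 : 0 < c * s ^ 2 := mul_pos hc (pow_pos hs.1 2)
  linarith

lemma hasDerivAt_integral_Ioo {F : ℝ → ℝ} {M c t : ℝ} (hF : ContinuousOn F (Ioo 0 M))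
    (hc : c ∈ Ioo 0 M) (ht : t ∈ Ioo 0 M) : HasDerivAt (fun q => ∫ s in c..q, F s) (F t) t := by
  apply intervalIntegral.integral_hasDerivAt_right
  · apply ContinuousOn.intervalIntegrable
    exact hF.mono (ordConnected_Ioo.uIcc_subset hc ht)
  · exact hF.stronglyMeasurableAtFilter isOpen_Ioo t ht
  · exact hF.continuousAt (isOpen_Ioo.mem_nhds ht)

lemma base_pos {γ s : ℝ} (hγ : 1 < γ) (hs : s ∈ Ioo 0 (qmaxF γ)) :
    0 < 1 - (γ - 1) / 2 * s ^ 2 := by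
  have h1 : s ^ 2 < 2 / (γ - 1) := (Real.lt_sqrt hs.1.le).1 hs.2
  have h2 : 0 < γ - 1 := by linarith
  rw [lt_div_iff₀ h2] at h1
  nlinarith

lemma rho_deriv {γ t : ℝ} (hγ : 1 < γ) (ht : 0 < 1 - (γ - 1) / 2 * t) :
    HasDerivAt (rhoF γ) (-(1 / 2) * rhoF γ t / (1 - (γ - 1) / 2 * t)) t := by
  have h1 : HasDerivAt (fun t : ℝ => 1 - (γ - 1) / 2 * t) (-((γ - 1) / 2)) t := by
    have := ((hasDerivAt_id t).const_mul ((γ - 1) / 2)).const_sub 1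
    simpa using this
  have h2 := h1.rpow_const (p := (1 : ℝ) / (γ - 1)) (Or.inl ht.ne')
  have h3 : γ - 1 ≠ 0 := by linarith
  refine HasDerivAt.congr_deriv h2 ?_
  rw [Real.rpow_sub_one ht.ne', rhoF]
  field_simp

lemma rho_pos {γ t : ℝ} (ht : 0 < 1 - (γ - 1) / 2 * t) : 0 < rhoF γ t := Real.rpow_pos_of_pos ht _

def Iint (γ s : ℝ) : ℝ :=
    (rhoF γ (s ^ 2) + 2 * s ^ 2 * deriv (rhoF γ) (s ^ 2)) / (s * (rhoF γ (s ^ 2)) ^ 2)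

lemma Iint_eq {γ s : ℝ} (hγ : 1 < γ) (hs : s ∈ Ioo 0 (qmaxF γ)) :
    Iint γ s = (1 - (γ + 1) / 2 * s ^ 2) / ((1 - (γ - 1) / 2 * s ^ 2) * s * rhoF γ (s ^ 2)) := by
  have hb := base_pos hγ hs
  have hr := rho_pos hb
  have hs0 := hs.1
  rw [Iint, (rho_deriv hγ hb).deriv]
  generalize rhoF γ (s ^ 2) = r at *
  obtain ⟨b, hbe⟩ : ∃ b, b = 1 - (γ - 1) / 2 * s ^ 2 := ⟨_, rfl⟩
  have : 1 - (γ + 1) / 2 * s ^ 2 = b - s ^ 2 := by rw [hbe]; ring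
  rw [this, ← hbe]
  rw [← hbe] at hb
  field_simp
  ring

lemma rho_sq_diff {γ s : ℝ} (hγ : 1 < γ) (hs : s ∈ Ioo 0 (qmaxF γ)) :
    DifferentiableAt ℝ (fun s => rhoF γ (s ^ 2)) s :=
  DifferentiableAt.comp (f := fun s : ℝ => s ^ 2) s (rho_deriv hγ (base_pos hγ hs)).differentiableAt (by fun_prop)

lemma Iint_diff {γ s : ℝ} (hγ : 1 < γ) (hs : s ∈ Ioo 0 (qmaxF γ)) :
    DifferentiableAt ℝ (Iint γ) s := by
  have hb := base_pos hγ hs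
  have hr := rho_pos hb
  have hs0 := hs.1
  have he : Iint γ =ᶠ[nhds s] fun s =>
      (1 - (γ + 1) / 2 * s ^ 2) / ((1 - (γ - 1) / 2 * s ^ 2) * s * rhoF γ (s ^ 2)) := by
    filter_upwards [isOpen_Ioo.mem_nhds hs] with s' hs' using Iint_eq hγ hs'
  refine DifferentiableAt.congr_of_eventuallyEq ?_ he
  refine DifferentiableAt.div (by fun_prop) ?_ (by positivity)
  exact DifferentiableAt.mul (by fun_prop) (rho_sq_diff hγ hs)

lemma cstar_mem {γ : ℝ} (hγ : 1 < γ) : cstar γ ∈ Ioo 0 (qmaxF γ) := by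
  have : 0 < γ - 1 := by linarith
  refine ⟨Real.sqrt_pos.2 (by positivity), Real.sqrt_lt_sqrt (by positivity) ?_⟩
  apply div_lt_div_of_pos_left <;> linarith

lemma A_deriv {γ t : ℝ} (hγ : 1 < γ) (ht : t ∈ Ioo 0 (qmaxF γ)) :
    HasDerivAt (Afun γ) (Iint γ t) t :=
  hasDerivAt_integral_Ioo (F := Iint γ)
    (fun s hs => (Iint_diff hγ hs).continuousAt.continuousWithinAt) (cstar_mem hγ) ht

lemma B_deriv {γ t : ℝ} (hγ : 1 < γ) (ht : t ∈ Ioo 0 (qmaxF γ)) :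
    HasDerivAt (Bfun γ) (rhoF γ (t ^ 2) / t) t :=
  hasDerivAt_integral_Ioo (F := fun t => rhoF γ (t ^ 2) / t)
    (fun s hs => ((rho_sq_diff hγ hs).div differentiableAt_id
      hs.1.ne').continuousAt.continuousWithinAt) (cstar_mem hγ) ht

lemma cstar_sq {γ : ℝ} (hγ : 1 < γ) : (γ + 1) / 2 * cstar γ ^ 2 = 1 := by
  rw [cstar, Real.sq_sqrt (by positivity)]
  field_simp

lemma core_chap {γ : ℝ} (hγ : 1 < γ)
    (δ y1 y2 : ℝ) (hδ : 0 < δ)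
    (q : ℝ × ℝ → ℝ) (L : NNReal)
    (hL : LipschitzOnWith L q (Icc 0 δ ×ˢ Icc y1 y2))
    (hC : ContDiffOn ℝ 2 q (Ioo 0 δ ×ˢ Ioo y1 y2))
    (heq : ∀ p ∈ Ioo 0 δ ×ˢ Ioo y1 y2, chap γ q p)
    (hle : ∀ p ∈ Icc 0 δ ×ˢ Icc y1 y2, q p ≤ cstar γ)
    (hlt : ∀ p ∈ Icc 0 δ ×ˢ Icc y1 y2, (0 < p.1 ∨ p.2 = y1 ∨ p.2 = y2) → q p < cstar γ)
    (y0 : ℝ) (hy0 : y0 ∈ Icc y1 y2) (hq0 : q (0, y0) = cstar γ) : False := by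
  have hc := cstar_mem hγ
  have hc0 := hc.1
  have hsub : ∀ t ∈ Icc (cstar γ / 2) (cstar γ), t ∈ Ioo 0 (qmaxF γ) :=
    fun t ht => ⟨by linarith [ht.1], ht.2.trans_lt hc.2⟩
  refine core_strip (Afun γ) (Bfun γ) (Iint γ) (cstar γ / 2) (cstar γ) (by linarith)
    ?_ ?_ ?_ ?_ (fun t ht => A_deriv hγ (hsub t ht)) (fun t ht => Iint_diff hγ (hsub t ht))
    (fun t ht => (B_deriv hγ (hsub t ht)).continuousAt) δ y1 y2 hδ q L hL hC heq hle hlt y0 hy0 hq0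
  · apply strictMonoOn_of_deriv_pos (convex_Icc _ _)
    · exact fun t ht => (A_deriv hγ (hsub t ht)).continuousAt.continuousWithinAt
    · intro t ht
      rw [interior_Icc] at ht
      have hm := hsub t (Ioo_subset_Icc_self ht)
      have hb := base_pos hγ hm
      have hr := rho_pos hb
      have ht0 := hm.1
      rw [(A_deriv hγ hm).deriv, Iint_eq hγ hm]
      have h1 := cstar_sq hγ
      have h2 : t ^ 2 < cstar γ ^ 2 := by
        have := ht.2
        gcongr
      have h3 : 0 < 1 - (γ + 1) / 2 * t ^ 2 := by
        have : (γ + 1) / 2 * t ^ 2 < (γ + 1) / 2 * cstar γ ^ 2 := by gcongr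
        linarith
      positivity
  · apply monotoneOn_of_deriv_nonneg (convex_Icc _ _)
    · exact fun t ht => (B_deriv hγ (hsub t ht)).continuousAt.continuousWithinAt
    · intro t ht
      rw [interior_Icc] at ht
      exact (B_deriv hγ (hsub t (Ioo_subset_Icc_self ht))).differentiableAt.differentiableWithinAt
    · intro t ht
      rw [interior_Icc] at ht
      have hm := hsub t (Ioo_subset_Icc_self ht)
      have hr := rho_pos (base_pos hγ hm)
      have ht0 := hm.1
      rw [(B_deriv hγ hm).deriv]
      positivity
  · simp [Afun]
  · have h := A_deriv hγ hc
    rwa [Iint_eq hγ hc, cstar_sq hγ, sub_self, zero_div] at h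

lemma chap_reflect {γ m : ℝ} {q : ℝ × ℝ → ℝ} {p : ℝ × ℝ} (h : chap γ q (m - p.1, p.2)) :
    chap γ (fun z => q (m - z.1, z.2)) p := by
  unfold chap pdx pdy at *
  simp only at *
  rw [← h]
  congr 1
  have h1 : (fun x => deriv (fun x => Afun γ (q (m - x, p.2))) x) =
      fun x => - deriv (fun x => Afun γ (q (x, p.2))) (m - x) := by
    funext x
    exact deriv_comp_const_sub (f := fun x => Afun γ (q (x, p.2))) m x
  rw [h1, deriv.fun_neg]
  rw [deriv_comp_const_sub (f := fun x => deriv (fun x => Afun γ (q (x, p.2))) x) m p.1]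
  ring

lemma chap_translate {γ m : ℝ} {q : ℝ × ℝ → ℝ} {p : ℝ × ℝ} (h : chap γ q (m + p.1, p.2)) :
    chap γ (fun z => q (m + z.1, z.2)) p := by
  unfold chap pdx pdy at *
  simp only at *
  rw [← h]
  congr 1
  have h1 : (fun x => deriv (fun x => Afun γ (q (m + x, p.2))) x) =
      fun x => deriv (fun x => Afun γ (q (x, p.2))) (m + x) := by
    funext x
    exact deriv_comp_const_add (f := fun x => Afun γ (q (x, p.2))) m x
  rw [h1]
  rw [deriv_comp_const_add (f := fun x => deriv (fun x => Afun γ (q (x, p.2))) x) m p.1]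

/-- a sonic curve `φ = h₀(ψ)` with subsonic flow on one side of it
cannot dip towards the subsonic region (Lemma `lemma-aaa1`). -/
theorem stmt_11 (γ : ℝ) (hγ : 1 < γ)
    (ψ1 ψ2 : ℝ) (hψ : ψ1 < ψ2)
    (h0 : ℝ → ℝ) (hcont : ContinuousOn h0 (Icc ψ1 ψ2)) :
    -- (i) subsonic on the left
    (∀ μ1 : ℝ, (∀ ψ ∈ Icc ψ1 ψ2, μ1 < h0 ψ) →
      ∀ q : ℝ × ℝ → ℝ,
        (∃ L : NNReal, LipschitzOnWith L q
          (closure {p : ℝ × ℝ | μ1 < p.1 ∧ p.1 < h0 p.2 ∧ ψ1 < p.2 ∧ p.2 < ψ2})) →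
        ContDiffOn ℝ 2 q {p : ℝ × ℝ | μ1 < p.1 ∧ p.1 < h0 p.2 ∧ ψ1 < p.2 ∧ p.2 < ψ2} →
        (∀ p ∈ {p : ℝ × ℝ | μ1 < p.1 ∧ p.1 < h0 p.2 ∧ ψ1 < p.2 ∧ p.2 < ψ2}, chap γ q p) →
        (∀ ψ ∈ Icc ψ1 ψ2, q (h0 ψ, ψ) = cstar γ) →
        (∀ p ∈ closure {p : ℝ × ℝ | μ1 < p.1 ∧ p.1 < h0 p.2 ∧ ψ1 < p.2 ∧ p.2 < ψ2},
          (¬ ∃ ψ ∈ Icc ψ1 ψ2, p = (h0 ψ, ψ)) → q p < cstar γ) →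
        ∀ ψ ∈ Icc ψ1 ψ2, min (h0 ψ1) (h0 ψ2) ≤ h0 ψ) ∧
    -- (ii) subsonic on the right
    (∀ μ2 : ℝ, (∀ ψ ∈ Icc ψ1 ψ2, h0 ψ < μ2) →
      ∀ q : ℝ × ℝ → ℝ,
        (∃ L : NNReal, LipschitzOnWith L q
          (closure {p : ℝ × ℝ | h0 p.2 < p.1 ∧ p.1 < μ2 ∧ ψ1 < p.2 ∧ p.2 < ψ2})) →
        ContDiffOn ℝ 2 q {p : ℝ × ℝ | h0 p.2 < p.1 ∧ p.1 < μ2 ∧ ψ1 < p.2 ∧ p.2 < ψ2} →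
        (∀ p ∈ {p : ℝ × ℝ | h0 p.2 < p.1 ∧ p.1 < μ2 ∧ ψ1 < p.2 ∧ p.2 < ψ2}, chap γ q p) →
        (∀ ψ ∈ Icc ψ1 ψ2, q (h0 ψ, ψ) = cstar γ) →
        (∀ p ∈ closure {p : ℝ × ℝ | h0 p.2 < p.1 ∧ p.1 < μ2 ∧ ψ1 < p.2 ∧ p.2 < ψ2},
          (¬ ∃ ψ ∈ Icc ψ1 ψ2, p = (h0 ψ, ψ)) → q p < cstar γ) →
        ∀ ψ ∈ Icc ψ1 ψ2, h0 ψ ≤ max (h0 ψ1) (h0 ψ2)) := by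
  have hne : (Icc ψ1 ψ2).Nonempty := ⟨ψ1, le_rfl, hψ.le⟩
  constructor
  · intro μ1 hμ q ⟨L, hL⟩ hC hchap hson hsub ψ hψm
    by_contra hcon
    push Not at hcon
    set R := {p : ℝ × ℝ | μ1 < p.1 ∧ p.1 < h0 p.2 ∧ ψ1 < p.2 ∧ p.2 < ψ2} with hR
    obtain ⟨y0, hy0, hmin⟩ := isCompact_Icc.exists_isMinOn hne hcont
    have hmin' : ∀ y ∈ Icc ψ1 ψ2, h0 y0 ≤ h0 y := fun y hy => hmin hy
    obtain ⟨m, hm⟩ : ∃ m, m = h0 y0 := ⟨_, rfl⟩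
    rw [← hm] at hmin'
    have hm1 : m < h0 ψ1 := (hmin' ψ hψm).trans_lt (hcon.trans_le (min_le_left _ _))
    have hm2 : m < h0 ψ2 := (hmin' ψ hψm).trans_lt (hcon.trans_le (min_le_right _ _))
    have hμm : μ1 < m := hm ▸ hμ y0 hy0
    obtain ⟨δ, hδ⟩ : ∃ δ, δ = (m - μ1) / 2 := ⟨_, rfl⟩
    have hδ0 : 0 < δ := by linarith
    have hmap : MapsTo (fun z : ℝ × ℝ => (m - z.1, z.2)) (Ioo 0 δ ×ˢ Ioo ψ1 ψ2) R := by
      rintro ⟨s, y⟩ ⟨⟨h1, h2⟩, h3⟩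
      have := hmin' y (Ioo_subset_Icc_self h3)
      simp only at h1 h2 h3
      exact ⟨by simp only; linarith, by simp only; linarith, h3⟩
    have hmapc : MapsTo (fun z : ℝ × ℝ => (m - z.1, z.2)) (Icc 0 δ ×ˢ Icc ψ1 ψ2) (closure R) := by
      have := hmap.closure (by fun_prop)
      rwa [closure_prod_eq, closure_Ioo hδ0.ne, closure_Ioo hψ.ne] at this
    have hcurve : ∀ p ∈ Icc 0 δ ×ˢ Icc ψ1 ψ2, (0 < p.1 ∨ p.2 = ψ1 ∨ p.2 = ψ2) →
        q (m - p.1, p.2) < cstar γ := by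
      intro p hp h
      refine hsub _ (hmapc hp) ?_
      rintro ⟨y, hy, he⟩
      rw [Prod.mk.injEq] at he
      obtain ⟨he1, he2⟩ := he
      have hp1 := hp.1.1
      subst he2
      rcases h with h | h | h
      · linarith [hmin' _ hy]
      · rw [h] at he1; linarith
      · rw [h] at he1; linarith
    refine core_chap hγ δ ψ1 ψ2 hδ0 (fun z => q (m - z.1, z.2)) L ?_ ?_
      (fun p hp => chap_reflect (hchap _ (hmap hp))) ?_ hcurve y0 hy0 ?_
    · have hl : LipschitzWith 1 (fun z : ℝ × ℝ => (m - z.1, z.2)) := by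
        apply LipschitzWith.of_dist_le_mul
        intro a b
        have : |m - a.1 - (m - b.1)| = |a.1 - b.1| := by
          rw [abs_sub_comm]; congr 1; ring
        simp only [Prod.dist_eq, Real.dist_eq, this, NNReal.coe_one, one_mul, le_refl]
      have h := hL.comp hl.lipschitzOnWith hmapc
      rw [mul_one] at h
      exact h
    · exact hC.comp (by fun_prop) hmap
    · intro p hp
      by_cases h : ∃ ψ ∈ Icc ψ1 ψ2, (m - p.1, p.2) = (h0 ψ, ψ)
      · obtain ⟨y, hy, he⟩ := h
        simp only [he, hson y hy, le_refl]
      · exact (hsub _ (hmapc hp) h).le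
    · simp only [sub_zero, hm, hson y0 hy0]
  · intro μ2 hμ q ⟨L, hL⟩ hC hchap hson hsub ψ hψm
    by_contra hcon
    push Not at hcon
    set R := {p : ℝ × ℝ | h0 p.2 < p.1 ∧ p.1 < μ2 ∧ ψ1 < p.2 ∧ p.2 < ψ2} with hR
    obtain ⟨y0, hy0, hmax⟩ := isCompact_Icc.exists_isMaxOn hne hcont
    have hmax' : ∀ y ∈ Icc ψ1 ψ2, h0 y ≤ h0 y0 := fun y hy => hmax hy
    obtain ⟨m, hm⟩ : ∃ m, m = h0 y0 := ⟨_, rfl⟩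
    rw [← hm] at hmax'
    have hm1 : h0 ψ1 < m := ((le_max_left _ _).trans_lt hcon).trans_le (hmax' ψ hψm)
    have hm2 : h0 ψ2 < m := ((le_max_right _ _).trans_lt hcon).trans_le (hmax' ψ hψm)
    have hμm : m < μ2 := hm ▸ hμ y0 hy0
    obtain ⟨δ, hδ⟩ : ∃ δ, δ = (μ2 - m) / 2 := ⟨_, rfl⟩
    have hδ0 : 0 < δ := by linarith
    have hmap : MapsTo (fun z : ℝ × ℝ => (m + z.1, z.2)) (Ioo 0 δ ×ˢ Ioo ψ1 ψ2) R := by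
      rintro ⟨s, y⟩ ⟨⟨h1, h2⟩, h3⟩
      have := hmax' y (Ioo_subset_Icc_self h3)
      simp only at h1 h2 h3
      exact ⟨by simp only; linarith, by simp only; linarith, h3⟩
    have hmapc : MapsTo (fun z : ℝ × ℝ => (m + z.1, z.2)) (Icc 0 δ ×ˢ Icc ψ1 ψ2) (closure R) := by
      have := hmap.closure (by fun_prop)
      rwa [closure_prod_eq, closure_Ioo hδ0.ne, closure_Ioo hψ.ne] at this
    have hcurve : ∀ p ∈ Icc 0 δ ×ˢ Icc ψ1 ψ2, (0 < p.1 ∨ p.2 = ψ1 ∨ p.2 = ψ2) →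
        q (m + p.1, p.2) < cstar γ := by
      intro p hp h
      refine hsub _ (hmapc hp) ?_
      rintro ⟨y, hy, he⟩
      rw [Prod.mk.injEq] at he
      obtain ⟨he1, he2⟩ := he
      have hp1 := hp.1.1
      subst he2
      rcases h with h | h | h
      · linarith [hmax' _ hy]
      · rw [h] at he1; linarith
      · rw [h] at he1; linarith
    refine core_chap hγ δ ψ1 ψ2 hδ0 (fun z => q (m + z.1, z.2)) L ?_ ?_
      (fun p hp => chap_translate (hchap _ (hmap hp))) ?_ hcurve y0 hy0 ?_
    · have hl : LipschitzWith 1 (fun z : ℝ × ℝ => (m + z.1, z.2)) := by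
        apply LipschitzWith.of_dist_le_mul
        intro a b
        simp [Prod.dist_eq]
      have h := hL.comp hl.lipschitzOnWith hmapc
      rw [mul_one] at h
      exact h
    · exact hC.comp (by fun_prop) hmap
    · intro p hp
      by_cases h : ∃ ψ ∈ Icc ψ1 ψ2, (m + p.1, p.2) = (h0 ψ, ψ)
      · obtain ⟨y, hy, he⟩ := h
        simp only [he, hson y hy, le_refl]
      · exact (hsub _ (hmapc hp) h).le
    · simp only [add_zero, hm, hson y0 hy0]
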